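/- arXiv:2211.12099 — 6 statements merged into one kernel-verified Lean document; each statement's English description precedes it below -/
import Mathlib

section
/- Let T > 0, ξ ∈ C([0,T]; ℝ), α ∈ (0,1], M ≥ 0, and let N : [0,T] → [0,∞) be non-increasing. For 0 ≤ s ≤ t ≤ T set D(s,t) := max_{r ∈ [s,t]} (ξ(r) − min_{[s,r]} ξ). Assume that for all 0 ≤ s ≤ t ≤ T with D(s,t) > 0 one has N(t) ≤ M/D(s,t) + (1−α) N(s). Then there exists a constant C, depending only on α, such that if D(0,T) > 0 then N(T) ≤ C · M / D(0,T). -/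
open Set

/-- The maximal "drawup" of `ξ` on `[s,t]`:
`D(s,t) := max_{r ∈ [s,t]} (ξ r - min_{[s,r]} ξ)`. -/
noncomputable def drawup (ξ : ℝ → ℝ) (s t : ℝ) : ℝ :=
  sSup ((fun r => ξ r - sInf (ξ '' Set.Icc s r)) '' Set.Icc s t)

/-- An increment of a continuous function over `[s, t]` is at most its drawup there. -/
lemma sub_le_drawup {ξ : ℝ → ℝ} {s t : ℝ} (hst : s ≤ t) (hξ : ContinuousOn ξ (Icc s t)) :
    ξ t - ξ s ≤ drawup ξ s t := by
  have hbelow : BddBelow (ξ '' Icc s t) := (isCompact_Icc.image_of_continuousOn hξ).bddBelow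
  obtain ⟨B, hB⟩ := (isCompact_Icc.image_of_continuousOn hξ).bddAbove
  have hbdd : BddAbove ((fun r => ξ r - sInf (ξ '' Icc s r)) '' Icc s t) := by
    refine ⟨B - sInf (ξ '' Icc s t), ?_⟩
    rintro _ ⟨r, hr, rfl⟩
    have h1 : ξ r ≤ B := hB (mem_image_of_mem ξ hr)
    have h2 : sInf (ξ '' Icc s t) ≤ sInf (ξ '' Icc s r) :=
      csInf_le_csInf hbelow ⟨ξ s, mem_image_of_mem ξ (left_mem_Icc.2 hr.1)⟩
        (image_mono (Icc_subset_Icc_right hr.2))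
    simp only
    linarith
  have h1 : ξ t - sInf (ξ '' Icc s t) ≤ drawup ξ s t :=
    le_csSup hbdd ⟨t, right_mem_Icc.2 hst, rfl⟩
  have h2 : sInf (ξ '' Icc s t) ≤ ξ s :=
    csInf_le hbelow (mem_image_of_mem ξ (left_mem_Icc.2 hst))
  linarith

/-- Every level strictly below the drawup is exceeded by an actual increment. -/
lemma exists_lt_sub_of_lt_drawup {ξ : ℝ → ℝ} {s t d : ℝ} (hst : s ≤ t)
    (hξ : ContinuousOn ξ (Icc s t)) (hd : d < drawup ξ s t) :
    ∃ a r, s ≤ a ∧ a ≤ r ∧ r ≤ t ∧ d < ξ r - ξ a := by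
  obtain ⟨_, ⟨r, hr, rfl⟩, hlt⟩ :=
    exists_lt_of_lt_csSup ((nonempty_Icc.2 hst).image _) hd
  obtain ⟨a, ha, heq⟩ := isCompact_Icc.exists_sInf_image_eq (nonempty_Icc.2 hr.1)
    (hξ.mono (Icc_subset_Icc_right hr.2))
  simp only [heq] at hlt
  exact ⟨a, r, ha.1, ha.2, hr.2, hlt⟩

/-- Iterating the decay estimate `n` times along geometrically decreasing levels above `ξ a`. -/
lemma le_div_sub_add_pow_mul {α T M a : ℝ} {ξ N : ℝ → ℝ} (hα : α ∈ Ioc (0 : ℝ) 1)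
    (hξ : ContinuousOn ξ (Icc 0 T)) (hM : 0 ≤ M)
    (hmono : ∀ s t : ℝ, 0 ≤ s → s ≤ t → t ≤ T → N t ≤ N s)
    (hdecay : ∀ s t : ℝ, 0 ≤ s → s ≤ t → t ≤ T → 0 < drawup ξ s t →
      N t ≤ M / drawup ξ s t + (1 - α) * N s)
    (ha : 0 ≤ a) (n : ℕ) :
    ∀ t, a ≤ t → t ≤ T → ξ a < ξ t →
      N t ≤ 4 / α ^ 2 * M / (ξ t - ξ a) + (1 - α) ^ n * N 0 := by
  obtain ⟨hα0, hα1⟩ := hα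
  induction n with
  | zero =>
    intro t hat htT hlt
    have h1 := hmono 0 t le_rfl (ha.trans hat) htT
    have h2 : 0 ≤ 4 / α ^ 2 * M / (ξ t - ξ a) :=
      div_nonneg (by positivity) (sub_pos.2 hlt).le
    simpa using h1.trans (le_add_of_nonneg_left h2)
  | succ n ih =>
    intro t hat htT hlt
    obtain ⟨x, hx⟩ : ∃ x, x = ξ t - ξ a := ⟨_, rfl⟩
    have hx0 : 0 < x := by linarith
    have hθ : 0 < 1 - α / 2 := by linarith
    obtain ⟨s, hs, hsx⟩ : ξ a + (1 - α / 2) * x ∈ ξ '' Icc a t :=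
      intermediate_value_Icc hat (hξ.mono (Icc_subset_Icc ha htT))
        ⟨by nlinarith, by nlinarith⟩
    have hsa : ξ s - ξ a = (1 - α / 2) * x := by linarith
    have hs0 : 0 ≤ s := ha.trans hs.1
    have hinc : α / 2 * x ≤ drawup ξ s t := by
      have := sub_le_drawup hs.2 (hξ.mono (Icc_subset_Icc hs0 htT))
      linarith
    have hpos : 0 < α / 2 * x := by positivity
    have h1 := hdecay s t hs0 hs.2 htT (hpos.trans_le hinc)
    have h2 : M / drawup ξ s t ≤ M / (α / 2 * x) := div_le_div_of_nonneg_left hM hpos hinc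
    have h3 := ih s hs.1 (hs.2.trans htT) (by nlinarith)
    rw [hsa] at h3
    have h4 := mul_le_mul_of_nonneg_left h3 (sub_nonneg.2 hα1)
    have h5 : M / (α / 2 * x) + (1 - α) * (4 / α ^ 2 * M / ((1 - α / 2) * x)) ≤
        4 / α ^ 2 * M / x := by
      have hratio : (1 - α) / (1 - α / 2) ≤ 1 - α / 2 := by
        rw [div_le_iff₀ hθ]
        nlinarith [sq_nonneg α]
      have hK : 0 ≤ 4 / α ^ 2 * M / x := by positivity
      have := mul_le_mul_of_nonneg_right hratio hK
      calc M / (α / 2 * x) + (1 - α) * (4 / α ^ 2 * M / ((1 - α / 2) * x))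
          = α / 2 * (4 / α ^ 2 * M / x) + (1 - α) / (1 - α / 2) * (4 / α ^ 2 * M / x) := by
            congr 1
            · field_simp
              norm_num
            · rw [div_mul_eq_div_div_swap]
              ring
        _ ≤ 4 / α ^ 2 * M / x := by linarith
    rw [← hx, pow_succ (1 - α) n]
    linarith

/-- Let `T > 0`, `ξ ∈ C([0,T];ℝ)`, `α ∈ (0,1]`, `M ≥ 0`, and let
`N : [0,T] → [0,∞)` be non-increasing. For `0 ≤ s ≤ t ≤ T` set
`D(s,t) := max_{r ∈ [s,t]} (ξ r - min_{[s,r]} ξ)`. Assume that for all `0 ≤ s ≤ t ≤ T`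
with `D(s,t) > 0` one has `N t ≤ M / D(s,t) + (1-α) N s`. Then there exists a constant
`C`, depending only on `α`, such that if `D(0,T) > 0` then `N T ≤ C * M / D(0,T)`. -/
theorem iteration_drawup_decay (α : ℝ) (hα : α ∈ Set.Ioc (0 : ℝ) 1) :
    ∃ C : ℝ, 0 < C ∧
      ∀ (T : ℝ), 0 < T →
      ∀ ξ : ℝ → ℝ, ContinuousOn ξ (Set.Icc 0 T) →
      ∀ M : ℝ, 0 ≤ M →
      ∀ N : ℝ → ℝ,
        (∀ t ∈ Set.Icc (0 : ℝ) T, 0 ≤ N t) →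
        (∀ s t : ℝ, 0 ≤ s → s ≤ t → t ≤ T → N t ≤ N s) →
        (∀ s t : ℝ, 0 ≤ s → s ≤ t → t ≤ T → 0 < drawup ξ s t →
          N t ≤ M / drawup ξ s t + (1 - α) * N s) →
        0 < drawup ξ 0 T →
        N T ≤ C * M / drawup ξ 0 T := by
  refine ⟨4 / α ^ 2, by have := hα.1; positivity, ?_⟩
  intro T hT ξ hξ M hM N _ hmono hdecay hD
  by_contra! hcon
  have hC : 0 ≤ 4 / α ^ 2 * M := by positivity
  have hNT : 0 < N T := (div_nonneg hC hD.le).trans_lt hcon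
  have hlevel : 4 / α ^ 2 * M / N T < drawup ξ 0 T := by
    rw [div_lt_iff₀ hD] at hcon
    rw [div_lt_iff₀ hNT]
    linarith
  obtain ⟨a, r, ha, har, hrT, hlt⟩ := exists_lt_sub_of_lt_drawup hT.le hξ hlevel
  have hx : 0 < ξ r - ξ a := (div_nonneg hC hNT.le).trans_lt hlt
  have hlim : Filter.Tendsto (fun n : ℕ => 4 / α ^ 2 * M / (ξ r - ξ a) + (1 - α) ^ n * N 0)
      Filter.atTop (nhds (4 / α ^ 2 * M / (ξ r - ξ a))) := by
    have h := tendsto_pow_atTop_nhds_zero_of_lt_one (sub_nonneg.2 hα.2)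
      (sub_lt_self 1 hα.1)
    simpa using (h.mul_const (N 0)).const_add (4 / α ^ 2 * M / (ξ r - ξ a))
  have hr : N r ≤ 4 / α ^ 2 * M / (ξ r - ξ a) :=
    ge_of_tendsto' hlim fun n =>
      le_div_sub_add_pow_mul hα hξ hM hmono hdecay ha n r har hrT (sub_pos.1 hx)
  have hle := (hmono r T (ha.trans har) hrT le_rfl).trans hr
  rw [le_div_iff₀ hx] at hle
  rw [div_lt_iff₀ hNT] at hlt
  linarith
end

section
/- Let q > 1, T > 0, ξ ∈ C([0,T]; ℝ), A > 0, C₂ ≥ 0, and let g : [0,T] → [0,∞) be non-increasing. Assume that for all 0 ≤ s ≤ t ≤ T with osc_{s,t}(ξ) > 0 one has g(t)^q ≤ A·g(s)/osc_{s,t}(ξ) + C₂. Then there exists a constant C, depending only on q, such that if osc_{0,T}(ξ) > 0 then g(T) ≤ C·((A/osc_{0,T}(ξ))^{1/(q−1)} + C₂^{1/q}). In particular the bound is independent of the value g(0). -/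
open Set

/-- The oscillation `osc_{s,t}(ξ) = max_{[s,t]} ξ - min_{[s,t]} ξ` of a (continuous)
function `ξ` on the interval `[s, t]`. -/
noncomputable def oscOn (ξ : ℝ → ℝ) (s t : ℝ) : ℝ :=
  sSup (ξ '' Set.Icc s t) - sInf (ξ '' Set.Icc s t)

theorem sub_le_oscOn {ξ : ℝ → ℝ} {s t x y : ℝ} (hξ : ContinuousOn ξ (Icc s t))
    (hx : x ∈ Icc s t) (hy : y ∈ Icc s t) : ξ x - ξ y ≤ oscOn ξ s t :=
  sub_le_sub (le_csSup (isCompact_Icc.image_of_continuousOn hξ).bddAbove (mem_image_of_mem ξ hx))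
    (csInf_le (isCompact_Icc.image_of_continuousOn hξ).bddBelow (mem_image_of_mem ξ hy))

theorem exists_oscOn_eq_sub {ξ : ℝ → ℝ} {s t : ℝ} (hst : s ≤ t) (hξ : ContinuousOn ξ (Icc s t)) :
    ∃ x ∈ Icc s t, ∃ y ∈ Icc s t, oscOn ξ s t = ξ x - ξ y := by
  have hne : (Icc s t).Nonempty := nonempty_Icc.2 hst
  obtain ⟨x, hx, hx'⟩ := isCompact_Icc.exists_sSup_image_eq hne hξ
  obtain ⟨y, hy, hy'⟩ := isCompact_Icc.exists_sInf_image_eq hne hξ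
  exact ⟨x, hx, y, hy, by rw [oscOn, hx', hy']⟩

theorem oscOn_nonneg {ξ : ℝ → ℝ} {s t : ℝ} (hst : s ≤ t) (hξ : ContinuousOn ξ (Icc s t)) :
    0 ≤ oscOn ξ s t := by
  simpa using sub_le_oscOn hξ (left_mem_Icc.2 hst) (left_mem_Icc.2 hst)

theorem oscOn_mono_right {ξ : ℝ → ℝ} {s t u : ℝ} (hst : s ≤ t) (htu : t ≤ u)
    (hξ : ContinuousOn ξ (Icc s u)) : oscOn ξ s t ≤ oscOn ξ s u := by
  have hsub : Icc s t ⊆ Icc s u := Icc_subset_Icc_right htu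
  obtain ⟨x, hx, y, hy, h⟩ := exists_oscOn_eq_sub hst (hξ.mono hsub)
  exact h ▸ sub_le_oscOn hξ (hsub hx) (hsub hy)

/-- An interval can be split so that each part carries at least half of the oscillation. -/
theorem exists_half_oscOn_le {ξ : ℝ → ℝ} {s t : ℝ} (hst : s ≤ t)
    (hξ : ContinuousOn ξ (Icc s t)) :
    ∃ m ∈ Icc s t, oscOn ξ s t / 2 ≤ oscOn ξ s m ∧ oscOn ξ s t / 2 ≤ oscOn ξ m t := by
  obtain ⟨x, hx, y, hy, h⟩ := exists_oscOn_eq_sub hst hξ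
  have hxy : ξ y ≤ ξ x := sub_nonneg.1 (h ▸ oscOn_nonneg hst hξ)
  obtain ⟨m, hm, hmid⟩ := intermediate_value_uIcc (hξ.mono (uIcc_subset_Icc hx hy))
    (show (ξ x + ξ y) / 2 ∈ uIcc (ξ x) (ξ y) by
      rw [uIcc_of_ge hxy]; constructor <;> linarith)
  have hm' : m ∈ Icc s t := uIcc_subset_Icc hx hy hm
  have hl := hξ.mono (Icc_subset_Icc_right hm'.2)
  have hr := hξ.mono (Icc_subset_Icc_left hm'.1)
  refine ⟨m, hm', ?_⟩
  rcases le_total x y with hle | hle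
  · rw [uIcc_of_le hle] at hm
    have h₁ := sub_le_oscOn hl ⟨hx.1, hm.1⟩ (right_mem_Icc.2 hm'.1)
    have h₂ := sub_le_oscOn hr (left_mem_Icc.2 hm'.2) ⟨hm.2, hy.2⟩
    constructor <;> linarith
  · rw [uIcc_of_ge hle] at hm
    have h₁ := sub_le_oscOn hl (right_mem_Icc.2 hm'.1) ⟨hy.1, hm.1⟩
    have h₂ := sub_le_oscOn hr ⟨hm.2, hx.2⟩ (left_mem_Icc.2 hm'.2)
    constructor <;> linarith

theorem le_of_rpow_le_mul_add {q x a d : ℝ} (hq : 1 < q) (hx : 0 ≤ x) (ha : 0 ≤ a) (hd : 0 ≤ d)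
    (h : x ^ q ≤ a * x + d) : x ≤ (2 * a) ^ (1 / (q - 1)) + (2 * d) ^ (1 / q) := by
  have hp : 0 < q - 1 := sub_pos.2 hq
  have h₁ : 0 ≤ (2 * a) ^ (1 / (q - 1)) := by positivity
  have h₂ : 0 ≤ (2 * d) ^ (1 / q) := by positivity
  rcases hx.eq_or_lt with rfl | hx0
  · linarith
  rcases le_total d (a * x) with hle | hle
  · have : x ^ (q - 1) ≤ 2 * a := by
      rw [Real.rpow_sub_one hx0.ne', div_le_iff₀ hx0]
      linarith
    have := (Real.le_rpow_inv_iff_of_pos hx (by positivity) hp).2 this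
    rw [← one_div] at this
    linarith
  · have := (Real.le_rpow_inv_iff_of_pos hx (by positivity : 0 ≤ 2 * d) (by linarith)).2
      (by linarith : x ^ q ≤ 2 * d)
    rw [← one_div] at this
    linarith

/-- Let `q > 1`, `T > 0`, `ξ ∈ C([0,T];ℝ)`, `A > 0`, `C₂ ≥ 0`, and let
`g : [0,T] → [0,∞)` be non-increasing. Assume that for all `0 ≤ s ≤ t ≤ T` with
`osc_{s,t}(ξ) > 0` one has `g(t)^q ≤ A·g(s)/osc_{s,t}(ξ) + C₂`. Then there exists a
constant `C`, depending only on `q`, such that if `osc_{0,T}(ξ) > 0` then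
`g(T) ≤ C·((A/osc_{0,T}(ξ))^{1/(q-1)} + C₂^{1/q})`. In particular the bound is
independent of the value `g 0`. -/
theorem iteration_superlinear_decay (q : ℝ) (hq : 1 < q) :
    ∃ C : ℝ, 0 < C ∧
      ∀ (T : ℝ), 0 < T →
      ∀ ξ : ℝ → ℝ, ContinuousOn ξ (Set.Icc 0 T) →
      ∀ A : ℝ, 0 < A →
      ∀ C₂ : ℝ, 0 ≤ C₂ →
      ∀ g : ℝ → ℝ,
        (∀ t ∈ Set.Icc (0 : ℝ) T, 0 ≤ g t) →
        (∀ s t : ℝ, 0 ≤ s → s ≤ t → t ≤ T → g t ≤ g s) →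
        (∀ s t : ℝ, 0 ≤ s → s ≤ t → t ≤ T → 0 < oscOn ξ s t →
          g t ^ q ≤ A * g s / oscOn ξ s t + C₂) →
        0 < oscOn ξ 0 T →
        g T ≤ C * ((A / oscOn ξ 0 T) ^ (1 / (q - 1)) + C₂ ^ (1 / q)) := by
  set p : ℝ := 1 / (q - 1) with hp_def
  have hq1 : 0 < q - 1 := sub_pos.2 hq
  have hq0 : 0 < q := by linarith
  have hp : 0 < p := by positivity
  have hpq : p * q = p + 1 := by
    rw [hp_def]; field_simp; ring
  refine ⟨(4 * 2 ^ p) ^ p + 2 ^ (1 / q), by positivity, ?_⟩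
  intro T hT ξ hξ A hA C₂ hC₂ g hg hmono hstep hO
  set O := oscOn ξ 0 T
  have hcont : ∀ {t}, t ≤ T → ContinuousOn ξ (Icc 0 t) := fun ht ↦
    hξ.mono (Icc_subset_Icc_right ht)
  have hosc : ∀ t ∈ Icc 0 T, 0 ≤ oscOn ξ 0 t := fun t ht ↦ oscOn_nonneg ht.1 (hcont ht.2)
  have hoscO : ∀ t ∈ Icc 0 T, oscOn ξ 0 t ≤ O := fun t ht ↦ oscOn_mono_right ht.1 ht.2 hξ
  have hTmem : T ∈ Icc 0 T := right_mem_Icc.2 hT.le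
  -- The quantity `g t * oscOn ξ 0 t ^ p` is scale-invariant, so its supremum controls itself.
  set φ : ℝ → ℝ := fun t ↦ g t * oscOn ξ 0 t ^ p with hφ
  have hφ0 : ∀ t ∈ Icc 0 T, 0 ≤ φ t := fun t ht ↦
    mul_nonneg (hg t ht) (Real.rpow_nonneg (hosc t ht) p)
  have hbdd : BddAbove (φ '' Icc 0 T) := by
    refine ⟨g 0 * O ^ p, ?_⟩
    rintro _ ⟨t, ht, rfl⟩
    exact mul_le_mul (hmono 0 t le_rfl ht.1 ht.2)
      (Real.rpow_le_rpow (hosc t ht) (hoscO t ht) hp.le) (Real.rpow_nonneg (hosc t ht) p)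
      (hg 0 (left_mem_Icc.2 hT.le))
  set S := sSup (φ '' Icc 0 T)
  have hφS : ∀ t ∈ Icc 0 T, φ t ≤ S := fun t ht ↦ le_csSup hbdd (mem_image_of_mem φ ht)
  have hS : 0 ≤ S := (hφ0 T hTmem).trans (hφS T hTmem)
  set a : ℝ := 2 * 2 ^ p * A with ha_def
  set d : ℝ := C₂ * O ^ (p * q) with hd_def
  have ha : 0 ≤ a := by positivity
  have hd : 0 ≤ d := by positivity
  have key : ∀ t ∈ Icc 0 T, φ t ^ q ≤ a * S + d := by
    intro t ht
    rcases (hosc t ht).eq_or_lt with h0 | hpos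
    · simp only [hφ, ← h0, Real.zero_rpow hp.ne', mul_zero, Real.zero_rpow hq0.ne']
      positivity
    set o := oscOn ξ 0 t
    obtain ⟨m, hm, hm₁, hm₂⟩ := exists_half_oscOn_le ht.1 (hcont ht.2)
    have hmT : m ∈ Icc 0 T := ⟨hm.1, hm.2.trans ht.2⟩
    have hgm := hg m hmT
    have h₁ : g t ^ q ≤ A * g m / (o / 2) + C₂ :=
      (hstep m t hm.1 hm.2 ht.2 (by linarith)).trans (by gcongr)
    have h₂ : g m * (o / 2) ^ p ≤ S :=
      (mul_le_mul_of_nonneg_left (Real.rpow_le_rpow (by positivity) hm₁ hp.le) hgm).trans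
        (hφS m hmT)
    have h₃ : o ^ (p * q) ≤ O ^ (p * q) :=
      Real.rpow_le_rpow hpos.le (hoscO t ht) (by positivity)
    have h₄ : o ^ (p * q) = 2 ^ p * (o / 2) ^ p * o := by
      rw [← Real.mul_rpow (by norm_num) (by positivity), mul_div_cancel₀ _ two_ne_zero, hpq,
        Real.rpow_add_one hpos.ne']
    calc φ t ^ q = g t ^ q * o ^ (p * q) := by
          rw [Real.mul_rpow (hg t ht) (by positivity), Real.rpow_mul hpos.le]
      _ ≤ (A * g m / (o / 2) + C₂) * o ^ (p * q) := by gcongr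
      _ = a * (g m * (o / 2) ^ p) + C₂ * o ^ (p * q) := by
          rw [add_mul, h₄, ha_def]; field_simp
      _ ≤ a * S + d :=
          add_le_add (mul_le_mul_of_nonneg_left h₂ ha) (mul_le_mul_of_nonneg_left h₃ hC₂)
  have hSq : S ^ q ≤ a * S + d := by
    rw [← Real.le_rpow_inv_iff_of_pos hS (by positivity) hq0]
    refine csSup_le ⟨_, mem_image_of_mem φ hTmem⟩ ?_
    rintro _ ⟨t, ht, rfl⟩
    exact (Real.le_rpow_inv_iff_of_pos (hφ0 t ht) (by positivity) hq0).2 (key t ht)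
  have hOp : 0 < O ^ p := by positivity
  have hfin := (hφS T hTmem).trans (le_of_rpow_le_mul_add hq hS ha hd hSq)
  have e₁ : (2 * a) ^ p = (4 * 2 ^ p) ^ p * (A / O) ^ p * O ^ p := by
    rw [mul_assoc, ← Real.mul_rpow (by positivity) hO.le, div_mul_cancel₀ _ hO.ne',
      ← Real.mul_rpow (by positivity) hA.le, ha_def]
    ring_nf
  have e₂ : (2 * d) ^ (1 / q) = 2 ^ (1 / q) * C₂ ^ (1 / q) * O ^ p := by
    rw [hd_def, Real.mul_rpow (by norm_num) hd, Real.mul_rpow hC₂ (by positivity),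
      ← Real.rpow_mul hO.le, mul_assoc p, mul_one_div_cancel hq0.ne', mul_one, mul_assoc]
  rw [← hp_def, e₁, e₂, ← add_mul] at hfin
  refine (le_of_mul_le_mul_right hfin hOp).trans ?_
  have h₁ : 0 ≤ (4 * (2 : ℝ) ^ p) ^ p * C₂ ^ (1 / q) := by positivity
  have h₂ : 0 ≤ (2 : ℝ) ^ (1 / q) * (A / O) ^ p := by positivity
  linarith
end

section
/- Let T > 0, ξ ∈ C([0,T]; ℝ), D > 0, C₂ ≥ 0, and let g : [0,T] → [0,∞) be non-increasing. Assume that g(t) ≤ (1/2)·g(s) + C₂ whenever 0 ≤ s ≤ t ≤ T and osc_{s,t}(ξ) ≥ D. Then g(T) ≤ 2^{−N}·g(0) + 2·C₂, where N = N^D_{0,T}(ξ). -/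
open Set

/-- `τ^D_0 := 0`, `τ^D_{k+1} := inf {t ≥ τ^D_k : osc_{τ^D_k, t}(ξ) = D} ∧ T`
(encoded as `inf ({t ≥ τ^D_k : osc_{τ^D_k,t}(ξ) = D} ∪ {T})`, which coincides with the
above since `inf ∅ = +∞`). -/
noncomputable def oscTimes (ξ : ℝ → ℝ) (D T : ℝ) : ℕ → ℝ
  | 0 => 0
  | k + 1 => sInf ({t : ℝ | oscTimes ξ D T k ≤ t ∧ oscOn ξ (oscTimes ξ D T k) t = D} ∪ {T})

/-- The counting function `N^D_{0,T}(ξ) := sup {k ≥ 0 : τ^D_k < T}`. -/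
noncomputable def oscCount (ξ : ℝ → ℝ) (D T : ℝ) : ℕ :=
  sSup {k : ℕ | oscTimes ξ D T k < T}

/-- If `oscOn ξ s t < D` and `ξ` is continuous at `t` from the right, then the oscillation stays
below `D` slightly to the right of `t`. -/
theorem exists_oscOn_lt_right {ξ : ℝ → ℝ} {s t T D : ℝ} (hst : s ≤ t) (htT : t < T)
    (hξ : ContinuousOn ξ (Set.Icc s T)) (h : oscOn ξ s t < D) :
    ∃ δ > 0, ∀ u, t ≤ u → u < t + δ → u ≤ T → oscOn ξ s u < D := by
  have hcpt : IsCompact (ξ '' Set.Icc s t) :=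
    isCompact_Icc.image_of_continuousOn (hξ.mono (Set.Icc_subset_Icc_right htT.le))
  obtain ⟨δ, hδ, hclose⟩ := Metric.continuousOn_iff.1 hξ t ⟨hst, htT.le⟩
    ((D - oscOn ξ s t) / 4) (by linarith)
  refine ⟨δ, hδ, fun u htu huδ huT => ?_⟩
  have hbound : ∀ y ∈ ξ '' Set.Icc s u,
      sInf (ξ '' Set.Icc s t) - (D - oscOn ξ s t) / 4 ≤ y ∧
        y ≤ sSup (ξ '' Set.Icc s t) + (D - oscOn ξ s t) / 4 := by
    rintro _ ⟨v, ⟨hsv, hvu⟩, rfl⟩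
    rcases le_total v t with hvt | htv
    · have h1 := csInf_le hcpt.bddBelow (Set.mem_image_of_mem ξ ⟨hsv, hvt⟩)
      have h2 := le_csSup hcpt.bddAbove (Set.mem_image_of_mem ξ ⟨hsv, hvt⟩)
      constructor <;> linarith
    · have h1 := csInf_le hcpt.bddBelow (Set.mem_image_of_mem ξ ⟨hst, le_rfl⟩)
      have h2 := le_csSup hcpt.bddAbove (Set.mem_image_of_mem ξ ⟨hst, le_rfl⟩)
      have h3 := hclose v ⟨hsv, hvu.trans huT⟩
        (by rw [Real.dist_eq, abs_lt]; constructor <;> linarith)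
      rw [Real.dist_eq, abs_lt] at h3
      constructor <;> linarith
  have hne : (ξ '' Set.Icc s u).Nonempty := (Set.nonempty_Icc.2 (hst.trans htu)).image ξ
  have hsup := csSup_le hne fun y hy => (hbound y hy).2
  have hinf := le_csInf hne fun y hy => (hbound y hy).1
  have hosc : oscOn ξ s t = sSup (ξ '' Set.Icc s t) - sInf (ξ '' Set.Icc s t) := rfl
  change sSup (ξ '' Set.Icc s u) - sInf (ξ '' Set.Icc s u) < D
  linarith

/-- The first time, capped at `T`, at which the oscillation started from `s` equals `D` actually
has oscillation at least `D`, provided it lies before `T`. -/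
theorem le_oscOn_sInf {ξ : ℝ → ℝ} {s T D : ℝ} (hsT : s ≤ T)
    (hξ : ContinuousOn ξ (Set.Icc s T))
    (h : sInf ({t : ℝ | s ≤ t ∧ oscOn ξ s t = D} ∪ {T}) < T) :
    D ≤ oscOn ξ s (sInf ({t : ℝ | s ≤ t ∧ oscOn ξ s t = D} ∪ {T})) := by
  have hne : ({t : ℝ | s ≤ t ∧ oscOn ξ s t = D} ∪ {T}).Nonempty := ⟨T, Or.inr rfl⟩
  have hlb : ∀ t ∈ {t : ℝ | s ≤ t ∧ oscOn ξ s t = D} ∪ {T}, s ≤ t := by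
    rintro t (ht | rfl)
    exacts [ht.1, hsT]
  by_contra! hlt
  obtain ⟨δ, hδ, hδosc⟩ := exists_oscOn_lt_right (le_csInf hne hlb) h hξ hlt
  obtain ⟨u, hu, hu'⟩ := exists_lt_of_csInf_lt hne (lt_min (lt_add_of_pos_right _ hδ) h)
  have hle := csInf_le ⟨s, hlb⟩ hu
  obtain ⟨huδ, huT⟩ := lt_min_iff.1 hu'
  rcases hu with hu | rfl
  · exact (hδosc u hle huδ huT.le).ne hu.2
  · exact huT.false

theorem oscTimes_le {T : ℝ} (hT : 0 ≤ T) (ξ : ℝ → ℝ) (D : ℝ) (k : ℕ) :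
    oscTimes ξ D T k ≤ T := by
  induction k with
  | zero => exact hT
  | succ k ih =>
    refine csInf_le ⟨oscTimes ξ D T k, ?_⟩ (Or.inr rfl)
    rintro t (ht | rfl)
    exacts [ht.1, ih]

theorem oscTimes_le_succ {T : ℝ} (hT : 0 ≤ T) (ξ : ℝ → ℝ) (D : ℝ) (k : ℕ) :
    oscTimes ξ D T k ≤ oscTimes ξ D T (k + 1) := by
  refine le_csInf ⟨T, Or.inr rfl⟩ ?_
  rintro t (ht | rfl)
  exacts [ht.1, oscTimes_le hT ξ D k]

theorem oscTimes_nonneg {T : ℝ} (hT : 0 ≤ T) (ξ : ℝ → ℝ) (D : ℝ) (k : ℕ) :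
    0 ≤ oscTimes ξ D T k :=
  monotone_nat_of_le_succ (oscTimes_le_succ hT ξ D) (Nat.zero_le k)

/-- The oscillation over `[τ_k, τ_{k+1}]` is at least `D` as long as `τ_{k+1} < T`. -/
theorem le_oscOn_oscTimes {T D : ℝ} (hT : 0 ≤ T) {ξ : ℝ → ℝ}
    (hξ : ContinuousOn ξ (Set.Icc 0 T)) {k : ℕ} (hk : oscTimes ξ D T (k + 1) < T) :
    D ≤ oscOn ξ (oscTimes ξ D T k) (oscTimes ξ D T (k + 1)) :=
  le_oscOn_sInf (oscTimes_le hT ξ D k)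
    (hξ.mono (Set.Icc_subset_Icc_left (oscTimes_nonneg hT ξ D k))) hk

/-- The number of oscillation times before `T` is `0` or is attained. -/
theorem oscTimes_oscCount_lt {T : ℝ} (hT : 0 < T) (ξ : ℝ → ℝ) (D : ℝ) :
    oscTimes ξ D T (oscCount ξ D T) < T := by
  by_cases hbdd : BddAbove {k : ℕ | oscTimes ξ D T k < T}
  · exact Nat.sSup_mem ⟨0, hT⟩ hbdd
  · rw [oscCount, Nat.sSup_of_not_bddAbove hbdd]
    exact hT

/-- Let `T > 0`, `ξ ∈ C([0,T];ℝ)`, `D > 0`, `C₂ ≥ 0`, and let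
`g : [0,T] → [0,∞)` be non-increasing. Assume that `g t ≤ (1/2) g s + C₂` whenever
`0 ≤ s ≤ t ≤ T` and `osc_{s,t}(ξ) ≥ D`. Then `g T ≤ 2^{-N} g 0 + 2 C₂`, where
`N = N^D_{0,T}(ξ)`. -/
theorem iteration_halving_decay (T : ℝ) (hT : 0 < T)
    (ξ : ℝ → ℝ) (hξ : ContinuousOn ξ (Set.Icc 0 T))
    (D : ℝ) (hD : 0 < D) (C₂ : ℝ) (hC₂ : 0 ≤ C₂)
    (g : ℝ → ℝ)
    (hg0 : ∀ t ∈ Set.Icc (0 : ℝ) T, 0 ≤ g t)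
    (hgmono : ∀ s t : ℝ, 0 ≤ s → s ≤ t → t ≤ T → g t ≤ g s)
    (hiter : ∀ s t : ℝ, 0 ≤ s → s ≤ t → t ≤ T → D ≤ oscOn ξ s t →
      g t ≤ (1 / 2) * g s + C₂) :
    g T ≤ g 0 / 2 ^ (oscCount ξ D T) + 2 * C₂ := by
  have key : ∀ k, oscTimes ξ D T k < T →
      g (oscTimes ξ D T k) ≤ g 0 / 2 ^ k + 2 * C₂ := by
    intro k
    induction k with
    | zero =>
      intro _
      simp only [oscTimes, pow_zero, div_one]
      linarith
    | succ k ih =>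
      intro hk
      have hle := oscTimes_le_succ hT.le ξ D k
      have h1 := ih (hle.trans_lt hk)
      have h2 := hiter _ _ (oscTimes_nonneg hT.le ξ D k) hle hk.le
        (le_oscOn_oscTimes hT.le hξ hk)
      have h3 : g 0 / 2 ^ (k + 1) = (1 / 2) * (g 0 / 2 ^ k) := by
        rw [pow_succ]; ring
      rw [h3]
      linarith
  have hN := oscTimes_oscCount_lt hT ξ D
  exact (hgmono _ _ (oscTimes_nonneg hT.le ξ D _) hN.le le_rfl).trans (key _ hN)
end

section
/- Let T > 0, ξ ∈ C¹([0,T]), F ∈ C¹(ℝ) non-decreasing, H ∈ C(ℝ), and let u be a classical solution of du = ∂_x(F(∂_x u)) dt + H(∂_x u) dξ on 𝕋 × [0,T]. Then for every convex E ∈ C²(ℝ) the map t ↦ ∫_𝕋 E(∂_x u(x,t)) dx is non-increasing on [0,T]. In particular, for every p ∈ [1,∞), the map t ↦ ∥∂_x u(·,t)∥_{L^p(𝕋)} is non-increasing. -/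
open Set MeasureTheory intervalIntegral

/-- A classical solution of `du = ∂ₓ(F(∂ₓu)) dt + H(∂ₓu) dξ` on `𝕋 × I`, where
`𝕋 = ℝ/ℤ` is realized as `1`-periodic functions of `x ∈ ℝ`: a function `u`,
`C²` in `x` and `C¹` in `t` (on `I`) with `∂ₜ∂ₓu` continuous, with space derivatives
`ux`, `uxx`, time derivative `ut` and mixed derivative `utx`, satisfying
`∂ₜu = ∂ₓ(F(∂ₓu)) + H(∂ₓu)·ξ'(t)` pointwise. -/
structure IsClassicalSolution (I : Set ℝ) (ξ F H : ℝ → ℝ)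
    (u ux uxx ut utx : ℝ → ℝ → ℝ) : Prop where
  periodic : ∀ x t, u (x + 1) t = u x t
  deriv_x : ∀ x : ℝ, ∀ t ∈ I, HasDerivAt (fun y => u y t) (ux x t) x
  deriv_xx : ∀ x : ℝ, ∀ t ∈ I, HasDerivAt (fun y => ux y t) (uxx x t) x
  deriv_t : ∀ x : ℝ, ∀ t ∈ I, HasDerivWithinAt (fun s => u x s) (ut x t) I t
  deriv_tx : ∀ x : ℝ, ∀ t ∈ I, HasDerivWithinAt (fun s => ux x s) (utx x t) I t
  cont_u : ContinuousOn (fun p : ℝ × ℝ => u p.1 p.2) (Set.univ ×ˢ I)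
  cont_ux : ContinuousOn (fun p : ℝ × ℝ => ux p.1 p.2) (Set.univ ×ˢ I)
  cont_uxx : ContinuousOn (fun p : ℝ × ℝ => uxx p.1 p.2) (Set.univ ×ˢ I)
  cont_ut : ContinuousOn (fun p : ℝ × ℝ => ut p.1 p.2) (Set.univ ×ˢ I)
  cont_utx : ContinuousOn (fun p : ℝ × ℝ => utx p.1 p.2) (Set.univ ×ˢ I)
  pde : ∀ x : ℝ, ∀ t ∈ I,
    ut x t = deriv (fun y => F (ux y t)) x + H (ux x t) * deriv ξ t

theorem continuous_slice_of_continuousOn_prod {g : ℝ → ℝ → ℝ} {I : Set ℝ}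
    (hg : ContinuousOn (fun p : ℝ × ℝ => g p.1 p.2) (Set.univ ×ˢ I)) {t : ℝ} (ht : t ∈ I) :
    Continuous (fun x => g x t) :=
  hg.comp_continuous (by fun_prop : Continuous fun x : ℝ => (x, t)) fun _ => ⟨mem_univ _, ht⟩

theorem continuousOn_intervalIntegral_of_continuousOn_prod {g : ℝ → ℝ → ℝ} {c d : ℝ} (hcd : c ≤ d)
    (hg : ContinuousOn (fun p : ℝ × ℝ => g p.1 p.2) (Set.univ ×ˢ Icc c d)) (a b : ℝ) :
    ContinuousOn (fun t => ∫ x in a..b, g x t) (Icc c d) := by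
  have hc : Continuous (Function.uncurry fun t x => g x (projIcc c d hcd t)) :=
    hg.comp_continuous (f := fun p : ℝ × ℝ => (p.2, (projIcc c d hcd p.1 : ℝ)))
      (continuous_snd.prodMk (continuous_subtype_val.comp (continuous_projIcc.comp continuous_fst)))
      fun p => ⟨mem_univ _, (projIcc c d hcd p.1).2⟩
  refine (intervalIntegral.continuous_parametric_intervalIntegral_of_continuous' hc
    (μ := volume) a b).continuousOn.congr fun t ht => ?_
  simp only [projIcc_of_mem hcd ht]

/-- Differentiation under the integral sign at an interior time. -/
theorem hasDerivAt_intervalIntegral_of_continuousOn_prod {g g' : ℝ → ℝ → ℝ} {c d : ℝ}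
    (hg : ContinuousOn (fun p : ℝ × ℝ => g p.1 p.2) (Set.univ ×ˢ Icc c d))
    (hg' : ContinuousOn (fun p : ℝ × ℝ => g' p.1 p.2) (Set.univ ×ˢ Icc c d))
    (hd : ∀ x, ∀ t ∈ Ioo c d, HasDerivAt (fun s => g x s) (g' x t) t)
    (a b : ℝ) {t : ℝ} (ht : t ∈ Ioo c d) :
    HasDerivAt (fun s => ∫ x in a..b, g x s) (∫ x in a..b, g' x t) t := by
  obtain ⟨C, hC⟩ := (isCompact_uIcc.prod isCompact_Icc).exists_bound_of_continuousOn
    (hg'.mono (prod_mono_left (subset_univ (uIcc a b))))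
  have htI := Ioo_subset_Icc_self ht
  refine (intervalIntegral.hasDerivAt_integral_of_dominated_loc_of_deriv_le
    (F := fun s x => g x s) (F' := fun s x => g' x s) (bound := fun _ => C)
    (Ioo_mem_nhds ht.1 ht.2) ?_ ?_ ?_ ?_ intervalIntegrable_const ?_).2
  · filter_upwards [Ioo_mem_nhds ht.1 ht.2] with s hs
    exact (continuous_slice_of_continuousOn_prod hg
      (Ioo_subset_Icc_self hs)).aestronglyMeasurable
  · exact (continuous_slice_of_continuousOn_prod hg htI).intervalIntegrable _ _
  · exact (continuous_slice_of_continuousOn_prod hg' htI).aestronglyMeasurable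
  · exact .of_forall fun x hx s hs =>
      hC (x, s) ⟨uIoc_subset_uIcc hx, Ioo_subset_Icc_self hs⟩
  · exact .of_forall fun x _ s hs => hd x s hs

theorem ConvexOn.deriv_deriv_nonneg {E : ℝ → ℝ} (hE : Differentiable ℝ E)
    (hconv : ConvexOn ℝ Set.univ E) (x : ℝ) : 0 ≤ deriv (deriv E) x :=
  Monotone.deriv_nonneg (monotoneOn_univ.1 (hconv.monotoneOn_deriv fun y _ => hE y))

namespace IsClassicalSolution

variable {I : Set ℝ} {T : ℝ} {ξ F H : ℝ → ℝ} {u ux uxx ut utx : ℝ → ℝ → ℝ}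

theorem ux_periodic (hu : IsClassicalSolution I ξ F H u ux uxx ut utx) {t : ℝ} (ht : t ∈ I)
    (x : ℝ) : ux (x + 1) t = ux x t := by
  have h := (hu.deriv_x (x + 1) t ht).comp_add_const x 1
  simp only [hu.periodic] at h
  exact h.unique (hu.deriv_x x t ht)

theorem hasDerivAt_t (hu : IsClassicalSolution (Icc 0 T) ξ F H u ux uxx ut utx) (x : ℝ) {t : ℝ}
    (ht : t ∈ Ioo 0 T) : HasDerivAt (fun s => u x s) (ut x t) t :=
  (hu.deriv_t x t (Ioo_subset_Icc_self ht)).hasDerivAt (Icc_mem_nhds ht.1 ht.2)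

theorem hasDerivAt_tx (hu : IsClassicalSolution (Icc 0 T) ξ F H u ux uxx ut utx) (x : ℝ) {t : ℝ}
    (ht : t ∈ Ioo 0 T) : HasDerivAt (fun s => ux x s) (utx x t) t :=
  (hu.deriv_tx x t (Ioo_subset_Icc_self ht)).hasDerivAt (Icc_mem_nhds ht.1 ht.2)

theorem ut_periodic (hu : IsClassicalSolution (Icc 0 T) ξ F H u ux uxx ut utx) {t : ℝ}
    (ht : t ∈ Ioo 0 T) (x : ℝ) : ut (x + 1) t = ut x t := by
  have h := hu.hasDerivAt_t (x + 1) ht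
  simp only [hu.periodic] at h
  exact h.unique (hu.hasDerivAt_t x ht)

/-- Symmetry of the mixed second derivatives. -/
theorem hasDerivAt_ut (hu : IsClassicalSolution (Icc 0 T) ξ F H u ux uxx ut utx) (x : ℝ) {t : ℝ}
    (ht : t ∈ Ioo 0 T) : HasDerivAt (fun y => ut y t) (utx x t) x := by
  have htI := Ioo_subset_Icc_self ht
  have key : ∀ y, ut y t = ut 0 t + ∫ z in (0 : ℝ)..y, utx z t := fun y => by
    have h1 := hasDerivAt_intervalIntegral_of_continuousOn_prod hu.cont_ux hu.cont_utx
      (fun x t ht => hu.hasDerivAt_tx x ht) 0 y ht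
    have h2 := (hu.hasDerivAt_t y ht).sub (hu.hasDerivAt_t 0 ht)
    have h3 := h2.congr_of_eventuallyEq (f₁ := fun s => ∫ z in (0 : ℝ)..y, ux z s) (by
      filter_upwards [Icc_mem_nhds ht.1 ht.2] with s hs
      exact intervalIntegral.integral_eq_sub_of_hasDerivAt (fun z _ => hu.deriv_x z s hs)
        ((continuous_slice_of_continuousOn_prod hu.cont_ux hs).intervalIntegrable _ _))
    linarith [h1.unique h3]
  rw [funext key]
  exact ((continuous_slice_of_continuousOn_prod hu.cont_utx htI).integral_hasStrictDerivAt
    0 x).hasDerivAt.const_add _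

theorem ut_eq (hu : IsClassicalSolution I ξ F H u ux uxx ut utx) (hF : Differentiable ℝ F)
    (x : ℝ) {t : ℝ} (ht : t ∈ I) :
    ut x t = deriv F (ux x t) * uxx x t + H (ux x t) * deriv ξ t := by
  rw [hu.pde x t ht]
  congr 1
  exact ((hF (ux x t)).hasDerivAt.comp x (hu.deriv_xx x t ht)).deriv

/-- The entropy dissipation inequality. -/
theorem integral_entropy_deriv_nonpos (hu : IsClassicalSolution (Icc 0 T) ξ F H u ux uxx ut utx)
    (hF : ContDiff ℝ 1 F) (hFmono : Monotone F) (hH : Continuous H) {E : ℝ → ℝ}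
    (hE : ContDiff ℝ 2 E) (hconv : ConvexOn ℝ Set.univ E) {t : ℝ} (ht : t ∈ Ioo 0 T) :
    ∫ x in (0 : ℝ)..1, deriv E (ux x t) * utx x t ≤ 0 := by
  have htI := Ioo_subset_Icc_self ht
  have hE1 : ContDiff ℝ 1 (deriv E) := ContDiff.deriv' (n := 1) (by simpa [one_add_one_eq_two] using hE)
  have cE2 : Continuous (deriv (deriv E)) := hE1.continuous_deriv le_rfl
  have cF : Continuous (deriv F) := hF.continuous_deriv le_rfl
  have cux := continuous_slice_of_continuousOn_prod hu.cont_ux htI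
  have cuxx := continuous_slice_of_continuousOn_prod hu.cont_uxx htI
  have cutx := continuous_slice_of_continuousOn_prod hu.cont_utx htI
  have hux : ux 1 t = ux 0 t := by simpa using hu.ux_periodic htI 0
  have hut : ut 1 t = ut 0 t := by simpa using hu.ut_periodic ht 0
  have hparts := intervalIntegral.integral_mul_deriv_eq_deriv_mul (a := 0) (b := 1)
    (u := fun x => deriv E (ux x t)) (u' := fun x => deriv (deriv E) (ux x t) * uxx x t)
    (fun x _ => ((hE1.differentiable one_ne_zero _).hasDerivAt.comp x (hu.deriv_xx x t htI)))
    (fun x _ => hu.hasDerivAt_ut x ht)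
    (((cE2.comp cux).mul cuxx).intervalIntegrable _ _) (cutx.intervalIntegrable _ _)
  have hnoise : ∫ x in (0 : ℝ)..1, deriv (deriv E) (ux x t) * H (ux x t) * uxx x t = 0 := by
    have h := intervalIntegral.integral_comp_mul_deriv (a := 0) (b := 1)
      (g := fun y => deriv (deriv E) y * H y)
      (fun x _ => hu.deriv_xx x t htI) cuxx.continuousOn (cE2.mul hH)
    rw [hux, intervalIntegral.integral_same] at h
    exact h
  have hsplit : ∫ x in (0 : ℝ)..1, deriv (deriv E) (ux x t) * uxx x t * ut x t
      = (∫ x in (0 : ℝ)..1, deriv (deriv E) (ux x t) * deriv F (ux x t) * uxx x t ^ 2)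
        + (∫ x in (0 : ℝ)..1, deriv (deriv E) (ux x t) * H (ux x t) * uxx x t) * deriv ξ t := by
    rw [← intervalIntegral.integral_mul_const, ← intervalIntegral.integral_add]
    · refine intervalIntegral.integral_congr fun x _ => ?_
      simp only [hu.ut_eq (hF.differentiable one_ne_zero) x htI]
      ring
    · exact Continuous.intervalIntegrable (by fun_prop) _ _
    · exact Continuous.intervalIntegrable (by fun_prop) _ _
  have hdiss : 0 ≤ ∫ x in (0 : ℝ)..1,
      deriv (deriv E) (ux x t) * deriv F (ux x t) * uxx x t ^ 2 :=
    intervalIntegral.integral_nonneg zero_le_one fun x _ =>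
      mul_nonneg (mul_nonneg (hconv.deriv_deriv_nonneg (hE.differentiable two_ne_zero) _)
        hFmono.deriv_nonneg) (sq_nonneg _)
  rw [hparts, hsplit, hnoise, hux, hut]
  linarith

theorem antitoneOn_integral_entropy
    (hu : IsClassicalSolution (Icc 0 T) ξ F H u ux uxx ut utx) (hT : 0 ≤ T)
    (hF : ContDiff ℝ 1 F) (hFmono : Monotone F) (hH : Continuous H) {E : ℝ → ℝ}
    (hE : ContDiff ℝ 2 E) (hconv : ConvexOn ℝ Set.univ E) :
    AntitoneOn (fun t => ∫ x in (0 : ℝ)..1, E (ux x t)) (Icc 0 T) := by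
  have cE : ContinuousOn (fun p : ℝ × ℝ => E (ux p.1 p.2)) (Set.univ ×ˢ Icc 0 T) :=
    hE.continuous.comp_continuousOn hu.cont_ux
  have cE' : ContinuousOn (fun p : ℝ × ℝ => deriv E (ux p.1 p.2) * utx p.1 p.2)
      (Set.univ ×ˢ Icc 0 T) :=
    ((hE.continuous_deriv one_le_two).comp_continuousOn hu.cont_ux).mul hu.cont_utx
  have hd : ∀ t ∈ Ioo 0 T, HasDerivAt (fun s => ∫ x in (0 : ℝ)..1, E (ux x s))
      (∫ x in (0 : ℝ)..1, deriv E (ux x t) * utx x t) t := fun t ht =>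
    hasDerivAt_intervalIntegral_of_continuousOn_prod (g := fun x t => E (ux x t))
      (g' := fun x t => deriv E (ux x t) * utx x t) cE cE'
      (fun x s hs => (hE.differentiable two_ne_zero _).hasDerivAt.comp s (hu.hasDerivAt_tx x hs))
      0 1 ht
  refine antitoneOn_of_deriv_nonpos (convex_Icc 0 T)
    (continuousOn_intervalIntegral_of_continuousOn_prod (g := fun x t => E (ux x t)) hT cE 0 1)
    ?_ ?_ <;> rw [interior_Icc]
  · exact fun t ht => (hd t ht).differentiableAt.differentiableWithinAt
  · intro t ht
    rw [(hd t ht).deriv]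
    exact hu.integral_entropy_deriv_nonpos hF hFmono hH hE hconv ht

end IsClassicalSolution

theorem Complex.ofReal_add_mul_I_ne_zero (x : ℝ) {ε : ℝ} (hε : ε ≠ 0) :
    (x : ℂ) + ε * Complex.I ≠ 0 := fun h => hε (by simpa using congrArg Complex.im h)

theorem contDiff_norm_add_mul_I_rpow {ε : ℝ} (hε : ε ≠ 0) (p : ℝ) {n : WithTop ℕ∞} :
    ContDiff ℝ n fun x : ℝ => ‖(x : ℂ) + ε * Complex.I‖ ^ p :=
  ((Complex.ofRealCLM.contDiff.add contDiff_const).norm ℝ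
    fun x => Complex.ofReal_add_mul_I_ne_zero x hε).rpow_const_of_ne
      fun x => norm_ne_zero_iff.2 (Complex.ofReal_add_mul_I_ne_zero x hε)

theorem convexOn_norm_add_mul_I_rpow (ε : ℝ) {p : ℝ} (hp : 1 ≤ p) :
    ConvexOn ℝ Set.univ fun x : ℝ => ‖(x : ℂ) + ε * Complex.I‖ ^ p := by
  have hnorm : ConvexOn ℝ Set.univ fun x : ℝ => ‖(x : ℂ) + ε * Complex.I‖ :=
    (convexOn_univ_norm (E := ℂ)).comp_affineMap
      (Complex.ofRealCLM.toLinearMap.toAffineMap + AffineMap.const ℝ ℝ (ε * Complex.I))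
  have hnonneg : (fun x : ℝ => ‖(x : ℂ) + ε * Complex.I‖) '' Set.univ ⊆ Ici 0 := by
    rintro _ ⟨x, -, rfl⟩
    exact norm_nonneg _
  have himage : Convex ℝ ((fun x : ℝ => ‖(x : ℂ) + ε * Complex.I‖) '' Set.univ) :=
    (isPreconnected_univ.image _ (by fun_prop)).ordConnected.convex
  exact ((convexOn_rpow hp).subset hnonneg himage).comp hnorm
    ((Real.monotoneOn_rpow_Ici_of_exponent_nonneg (zero_le_one.trans hp)).mono hnonneg)

open Topology in
theorem tendsto_integral_norm_add_mul_I_rpow {g : ℝ → ℝ} (hg : Continuous g) {p : ℝ} (hp : 0 ≤ p)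
    (a b : ℝ) :
    Filter.Tendsto (fun ε : ℝ => ∫ x in a..b, ‖(g x : ℂ) + ε * Complex.I‖ ^ p) (𝓝[>] 0)
      (𝓝 (∫ x in a..b, |g x| ^ p)) := by
  have hc : Continuous (Function.uncurry fun ε x : ℝ => ‖(g x : ℂ) + ε * Complex.I‖ ^ p) :=
    Continuous.rpow_const (by fun_prop) fun _ => .inr hp
  have h := (intervalIntegral.continuous_parametric_intervalIntegral_of_continuous' hc
    (μ := volume) a b).tendsto 0
  simp only [Complex.ofReal_zero, zero_mul, add_zero, Complex.norm_real, Real.norm_eq_abs] at h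
  exact h.mono_left nhdsWithin_le_nhds

/-- Let `T > 0`, `ξ ∈ C¹([0,T])`, `F ∈ C¹(ℝ)` non-decreasing,
`H ∈ C(ℝ)`, and let `u` be a classical solution of `du = ∂ₓ(F(∂ₓu)) dt + H(∂ₓu) dξ` on
`𝕋 × [0,T]`. Then for every convex `E ∈ C²(ℝ)` the map `t ↦ ∫_𝕋 E(∂ₓu(x,t)) dx` is
non-increasing on `[0,T]`; in particular, for every `p ∈ [1,∞)` the map
`t ↦ ‖∂ₓu(·,t)‖_{L^p(𝕋)}` is non-increasing. -/
theorem entropy_nonincreasing (T : ℝ) (hT : 0 < T)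
    (ξ F H : ℝ → ℝ) (hξ : ContDiff ℝ 1 ξ) (hF : ContDiff ℝ 1 F) (hFmono : Monotone F)
    (hH : Continuous H)
    (u ux uxx ut utx : ℝ → ℝ → ℝ)
    (hu : IsClassicalSolution (Set.Icc 0 T) ξ F H u ux uxx ut utx) :
    (∀ E : ℝ → ℝ, ContDiff ℝ 2 E → ConvexOn ℝ Set.univ E →
      ∀ s ∈ Set.Icc (0 : ℝ) T, ∀ t ∈ Set.Icc (0 : ℝ) T, s ≤ t →
        ∫ x in (0 : ℝ)..1, E (ux x t) ≤ ∫ x in (0 : ℝ)..1, E (ux x s)) ∧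
    (∀ p : ℝ, 1 ≤ p →
      ∀ s ∈ Set.Icc (0 : ℝ) T, ∀ t ∈ Set.Icc (0 : ℝ) T, s ≤ t →
        (∫ x in (0 : ℝ)..1, |ux x t| ^ p) ^ (1 / p)
          ≤ (∫ x in (0 : ℝ)..1, |ux x s| ^ p) ^ (1 / p)) := by
  refine ⟨fun E hE hconv s hs t ht hst =>
    hu.antitoneOn_integral_entropy hT.le hF hFmono hH hE hconv hs ht hst,
    fun p hp s hs t ht hst => ?_⟩
  have hp0 : 0 ≤ p := zero_le_one.trans hp
  refine Real.rpow_le_rpow (intervalIntegral.integral_nonneg zero_le_one fun x _ => by positivity)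
    ?_ (one_div_nonneg.2 hp0)
  refine le_of_tendsto_of_tendsto
    (tendsto_integral_norm_add_mul_I_rpow
      (continuous_slice_of_continuousOn_prod hu.cont_ux ht) hp0 0 1)
    (tendsto_integral_norm_add_mul_I_rpow
      (continuous_slice_of_continuousOn_prod hu.cont_ux hs) hp0 0 1) ?_
  filter_upwards [self_mem_nhdsWithin] with ε hε
  exact hu.antitoneOn_integral_entropy hT.le hF hFmono hH
    (contDiff_norm_add_mul_I_rpow (ne_of_gt hε) p) (convexOn_norm_add_mul_I_rpow ε hp) hs ht hst
end

section
/- Let ξ ∈ C¹([0,∞)), F ∈ C²(ℝ) with F' ≥ 0 and F' even, H ∈ C¹(ℝ), and let E : ℝ → [0,∞) be smooth, convex and even. Set G(r) := ∫_0^r (F'(w) E''(w))^{1/2} dw. Let u be a smooth classical solution of du = ∂_x(F(∂_x u)) dt + H(∂_x u) dξ on 𝕋 × [0,∞). Then there exists a universal constant C > 0 such that for all T > 0: G(∥∂_x u(·,T)∥_∞)² ≤ (C/T) · ∫_𝕋 E(∂_x u(x,0)) dx. -/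
open Set MeasureTheory intervalIntegral

/-- A smooth classical solution of `du = ∂ₓ(F(∂ₓu)) dt + H(∂ₓu) dξ` on `𝕋 × I`, where
`𝕋 = ℝ/ℤ` is realized as `1`-periodic functions of `x ∈ ℝ`: a function `u`,
`C³` in `x` and `C¹` in `t` (on `I`) with `∂ₜ∂ₓu` continuous, with space derivatives
`ux`, `uxx`, `uxxx`, time derivative `ut` and mixed derivative `utx`, satisfying
`∂ₜu = ∂ₓ(F(∂ₓu)) + H(∂ₓu)·ξ'(t)` pointwise. -/
structure IsSmoothClassicalSolution (I : Set ℝ) (ξ F H : ℝ → ℝ)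
    (u ux uxx uxxx ut utx : ℝ → ℝ → ℝ) : Prop where
  periodic : ∀ x t, u (x + 1) t = u x t
  deriv_x : ∀ x : ℝ, ∀ t ∈ I, HasDerivAt (fun y => u y t) (ux x t) x
  deriv_xx : ∀ x : ℝ, ∀ t ∈ I, HasDerivAt (fun y => ux y t) (uxx x t) x
  deriv_xxx : ∀ x : ℝ, ∀ t ∈ I, HasDerivAt (fun y => uxx y t) (uxxx x t) x
  deriv_t : ∀ x : ℝ, ∀ t ∈ I, HasDerivWithinAt (fun s => u x s) (ut x t) I t
  deriv_tx : ∀ x : ℝ, ∀ t ∈ I, HasDerivWithinAt (fun s => ux x s) (utx x t) I t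
  cont_u : ContinuousOn (fun p : ℝ × ℝ => u p.1 p.2) (Set.univ ×ˢ I)
  cont_ux : ContinuousOn (fun p : ℝ × ℝ => ux p.1 p.2) (Set.univ ×ˢ I)
  cont_uxx : ContinuousOn (fun p : ℝ × ℝ => uxx p.1 p.2) (Set.univ ×ˢ I)
  cont_uxxx : ContinuousOn (fun p : ℝ × ℝ => uxxx p.1 p.2) (Set.univ ×ˢ I)
  cont_ut : ContinuousOn (fun p : ℝ × ℝ => ut p.1 p.2) (Set.univ ×ˢ I)
  cont_utx : ContinuousOn (fun p : ℝ × ℝ => utx p.1 p.2) (Set.univ ×ˢ I)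
  pde : ∀ x : ℝ, ∀ t ∈ I,
    ut x t = deriv (fun y => F (ux y t)) x + H (ux x t) * deriv ξ t

lemma continuous_slice_of_continuousOn {g : ℝ → ℝ → ℝ}
    (hg : ContinuousOn (fun p : ℝ × ℝ => g p.1 p.2) (univ ×ˢ Ici 0)) {t : ℝ} (ht : 0 ≤ t) :
    Continuous fun x => g x t :=
  hg.comp_continuous (f := fun x : ℝ => (x, t)) (by fun_prop) fun _ => ⟨mem_univ _, ht⟩

/-- Differentiation under the integral sign for functions of `(x, t)` with `t > 0`. -/
lemma hasDerivAt_intervalIntegral_of_continuousOn {f f' : ℝ → ℝ → ℝ}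
    (hf : ContinuousOn (fun p : ℝ × ℝ => f p.1 p.2) (univ ×ˢ Ici 0))
    (hf' : ContinuousOn (fun p : ℝ × ℝ => f' p.1 p.2) (univ ×ˢ Ici 0))
    (hd : ∀ x t, 0 < t → HasDerivAt (f x) (f' x t) t) (a b : ℝ) {t : ℝ} (ht : 0 < t) :
    HasDerivAt (fun s => ∫ x in a..b, f x s) (∫ x in a..b, f' x t) t := by
  obtain ⟨K, hK⟩ := (isCompact_uIcc.prod isCompact_Icc).exists_bound_of_continuousOn
    (hf'.mono (prod_mono (subset_univ (uIcc a b))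
      (fun s (hs : s ∈ Icc (t / 2) (2 * t)) => mem_Ici.2 (by linarith [hs.1]))))
  refine (hasDerivAt_integral_of_dominated_loc_of_deriv_le (bound := fun _ => K)
    (F := fun s x => f x s) (F' := fun s x => f' x s)
    (Icc_mem_nhds (show t / 2 < t by linarith) (show t < 2 * t by linarith)) ?_
    ((continuous_slice_of_continuousOn hf ht.le).intervalIntegrable _ _)
    (continuous_slice_of_continuousOn hf' ht.le).aestronglyMeasurable
    (.of_forall fun x hx s hs => hK (x, s) ⟨uIoc_subset_uIcc hx, hs⟩) (by simp)
    (.of_forall fun x _ s hs => hd x s (by linarith [hs.1]))).2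
  filter_upwards [lt_mem_nhds ht] with s hs using
    (continuous_slice_of_continuousOn hf hs.le).aestronglyMeasurable

lemma continuousOn_intervalIntegral_of_continuousOn {f : ℝ → ℝ → ℝ}
    (hf : ContinuousOn (fun p : ℝ × ℝ => f p.1 p.2) (univ ×ˢ Ici 0)) (a b : ℝ) :
    ContinuousOn (fun t => ∫ x in a..b, f x t) (Ici 0) := by
  have h : Continuous fun t => ∫ x in a..b, f x (max 0 t) := by
    refine continuous_parametric_intervalIntegral_of_continuous' (f := fun t x => f x (max 0 t))
      ?_ a b
    exact hf.comp_continuous (f := fun p : ℝ × ℝ => (p.2, max 0 p.1)) (by fun_prop)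
      fun p => ⟨mem_univ _, mem_Ici.2 (le_max_left _ _)⟩
  exact h.continuousOn.congr fun t ht => by simp only [max_eq_right (mem_Ici.1 ht)]

lemma hasDerivAt_max_zero_pow (n : ℕ) (y : ℝ) :
    HasDerivAt (fun y : ℝ => max 0 y ^ (n + 2)) ((n + 2) * max 0 y ^ (n + 1)) y := by
  rcases lt_trichotomy y 0 with hy | rfl | hy
  · refine ((hasDerivAt_const y (0 : ℝ)).congr_of_eventuallyEq ?_).congr_deriv ?_
    · filter_upwards [gt_mem_nhds hy] with z hz
      simp [max_eq_left hz.le]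
    · simp [max_eq_left hy.le]
  · rw [← hasDerivWithinAt_univ, ← Iic_union_Ici (a := (0 : ℝ))]
    refine HasDerivWithinAt.union ?_ ?_
    · refine ((hasDerivWithinAt_const (0 : ℝ) _ (0 : ℝ)).congr (fun z hz => ?_) ?_).congr_deriv ?_
      · simp [max_eq_left (mem_Iic.1 hz)]
      · simp
      · simp
    · refine (((hasDerivAt_pow (n + 2) (0 : ℝ)).hasDerivWithinAt).congr (fun z hz => ?_)
        ?_).congr_deriv ?_
      · simp [max_eq_right (mem_Ici.1 hz)]
      · simp
      · simp
  · refine ((hasDerivAt_pow (n + 2) y).congr_of_eventuallyEq ?_).congr_deriv ?_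
    · filter_upwards [lt_mem_nhds hy] with z hz
      simp [max_eq_right hz.le]
    · simp [max_eq_right hy.le]

lemma sq_intervalIntegral_abs_le {f : ℝ → ℝ} (hf : Continuous f) :
    (∫ x in (0 : ℝ)..1, |f x|) ^ 2 ≤ ∫ x in (0 : ℝ)..1, f x ^ 2 := by
  set c := ∫ x in (0 : ℝ)..1, |f x| with hc
  have h : 0 ≤ ∫ x in (0 : ℝ)..1, (f x ^ 2 - 2 * c * |f x| + c ^ 2) :=
    integral_nonneg zero_le_one fun x _ => by nlinarith [sq_nonneg (|f x| - c), sq_abs (f x)]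
  rw [intervalIntegral.integral_add (Continuous.intervalIntegrable (by fun_prop) _ _) (by simp),
    intervalIntegral.integral_sub (Continuous.intervalIntegrable (by fun_prop) _ _)
      (Continuous.intervalIntegrable (by fun_prop) _ _),
    intervalIntegral.integral_const_mul, ← hc] at h
  simp only [intervalIntegral.integral_const, sub_zero, one_smul] at h
  nlinarith

namespace IsSmoothClassicalSolution

variable {ξ F H : ℝ → ℝ} {u ux uxx uxxx ut utx : ℝ → ℝ → ℝ}

lemma ux_periodic (hu : IsSmoothClassicalSolution (Ici 0) ξ F H u ux uxx uxxx ut utx)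
    (x : ℝ) {t : ℝ} (ht : 0 ≤ t) : ux (x + 1) t = ux x t := by
  have h := (hu.deriv_x (x + 1) t ht).comp_add_const x 1
  simp only [hu.periodic] at h
  exact h.unique (hu.deriv_x x t ht)

lemma ut_periodic (hu : IsSmoothClassicalSolution (Ici 0) ξ F H u ux uxx uxxx ut utx)
    (x : ℝ) {t : ℝ} (ht : 0 < t) : ut (x + 1) t = ut x t := by
  have h := (hu.deriv_t (x + 1) t ht.le).hasDerivAt (Ici_mem_nhds ht)
  simp only [hu.periodic] at h
  exact h.unique ((hu.deriv_t x t ht.le).hasDerivAt (Ici_mem_nhds ht))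

/-- Symmetry of the mixed derivative: `∂ₓ∂ₜu = ∂ₜ∂ₓu`. -/
lemma hasDerivAt_ut (hu : IsSmoothClassicalSolution (Ici 0) ξ F H u ux uxx uxxx ut utx)
    (x : ℝ) {t : ℝ} (ht : 0 < t) : HasDerivAt (fun y => ut y t) (utx x t) x := by
  have hut : ∀ y, ut y t = ut 0 t + ∫ z in (0 : ℝ)..y, utx z t := fun y => by
    have h₁ : HasDerivAt (fun s => ∫ z in (0 : ℝ)..y, ux z s) (∫ z in (0 : ℝ)..y, utx z t) t :=
      hasDerivAt_intervalIntegral_of_continuousOn hu.cont_ux hu.cont_utx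
        (fun z s hs => (hu.deriv_tx z s hs.le).hasDerivAt (Ici_mem_nhds hs)) 0 y ht
    have h₂ : HasDerivAt (fun s => u y s - u 0 s) (ut y t - ut 0 t) t :=
      ((hu.deriv_t y t ht.le).hasDerivAt (Ici_mem_nhds ht)).sub
        ((hu.deriv_t 0 t ht.le).hasDerivAt (Ici_mem_nhds ht))
    have h₃ := h₂.unique (h₁.congr_of_eventuallyEq ?_)
    · linarith
    · filter_upwards [lt_mem_nhds ht] with s hs
      exact (integral_eq_sub_of_hasDerivAt (fun z _ => hu.deriv_x z s hs.le)
        ((continuous_slice_of_continuousOn hu.cont_ux hs.le).intervalIntegrable _ _)).symm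
  have hc := continuous_slice_of_continuousOn hu.cont_utx ht.le
  rw [funext hut]
  exact (integral_hasDerivAt_right (hc.intervalIntegrable 0 x)
    (hc.stronglyMeasurableAtFilter _ _) hc.continuousAt).const_add _

/-- The dissipation of the entropy with second derivative `φ''` at time `t`. -/
lemma integral_deriv_mul_utx (hu : IsSmoothClassicalSolution (Ici 0) ξ F H u ux uxx uxxx ut utx)
    (hF : Differentiable ℝ F) (hF' : Continuous (deriv F)) (hH : Continuous H) {φ' φ'' : ℝ → ℝ}
    (hφ' : ∀ r, HasDerivAt φ' (φ'' r) r) (hφ'' : Continuous φ'') {t : ℝ} (ht : 0 < t) :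
    ∫ x in (0 : ℝ)..1, φ' (ux x t) * utx x t =
      -∫ x in (0 : ℝ)..1, deriv F (ux x t) * φ'' (ux x t) * uxx x t ^ 2 := by
  have hux := continuous_slice_of_continuousOn hu.cont_ux ht.le
  have huxx := continuous_slice_of_continuousOn hu.cont_uxx ht.le
  have hutx := continuous_slice_of_continuousOn hu.cont_utx ht.le
  have hper : ux 1 t = ux 0 t := by simpa using hu.ux_periodic 0 ht.le
  have hper' : ut 1 t = ut 0 t := by simpa using hu.ut_periodic 0 ht
  have hpde : ∀ x, ut x t = deriv F (ux x t) * uxx x t + H (ux x t) * deriv ξ t := fun x => by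
    have h : HasDerivAt (fun y => F (ux y t)) (deriv F (ux x t) * uxx x t) x :=
      (hF _).hasDerivAt.comp x (hu.deriv_xx x t ht.le)
    rw [hu.pde x t ht.le, h.deriv]
  have hnoise : ∫ x in (0 : ℝ)..1, (φ'' (ux x t) * H (ux x t)) * uxx x t = 0 := by
    have h := integral_comp_mul_deriv (a := 0) (b := 1) (g := fun r => φ'' r * H r)
      (fun x _ => hu.deriv_xx x t ht.le) huxx.continuousOn (hφ''.mul hH)
    simpa [hper] using h
  rw [integral_mul_deriv_eq_deriv_mul (u := fun x => φ' (ux x t)) (v := fun x => ut x t)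
    (u' := fun x => φ'' (ux x t) * uxx x t)
    (fun x _ => (hφ' _).comp x (hu.deriv_xx x t ht.le)) (fun x _ => hu.hasDerivAt_ut x ht)
    (Continuous.intervalIntegrable (by fun_prop) _ _) (hutx.intervalIntegrable _ _), hper, hper',
    sub_self, zero_sub]
  congr 1
  calc ∫ x in (0 : ℝ)..1, φ'' (ux x t) * uxx x t * ut x t
      = ∫ x in (0 : ℝ)..1, (deriv F (ux x t) * φ'' (ux x t) * uxx x t ^ 2 +
          deriv ξ t * ((φ'' (ux x t) * H (ux x t)) * uxx x t)) := by
        congr 1 with x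
        rw [hpde]
        ring
    _ = _ := by
        rw [intervalIntegral.integral_add (Continuous.intervalIntegrable (by fun_prop) _ _)
          (Continuous.intervalIntegrable (by fun_prop) _ _),
          intervalIntegral.integral_const_mul, hnoise, mul_zero, add_zero]

lemma continuousOn_dissipation
    (hu : IsSmoothClassicalSolution (Ici 0) ξ F H u ux uxx uxxx ut utx)
    (hF' : Continuous (deriv F)) {φ'' : ℝ → ℝ} (hφ'' : Continuous φ'') :
    ContinuousOn (fun t => ∫ x in (0 : ℝ)..1, deriv F (ux x t) * φ'' (ux x t) * uxx x t ^ 2)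
      (Ici 0) :=
  continuousOn_intervalIntegral_of_continuousOn
    (((hF'.comp_continuousOn hu.cont_ux).mul (hφ''.comp_continuousOn hu.cont_ux)).mul
      (hu.cont_uxx.pow 2)) 0 1

/-- The entropy balance: the noise does not contribute. -/
lemma integral_dissipation (hu : IsSmoothClassicalSolution (Ici 0) ξ F H u ux uxx uxxx ut utx)
    (hF : Differentiable ℝ F) (hF' : Continuous (deriv F)) (hH : Continuous H) {φ φ' φ'' : ℝ → ℝ}
    (hφ : ∀ r, HasDerivAt φ (φ' r) r) (hφ' : ∀ r, HasDerivAt φ' (φ'' r) r)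
    (hφ'' : Continuous φ'') {s T : ℝ} (hs : 0 ≤ s) (hsT : s ≤ T) :
    ∫ t in s..T, ∫ x in (0 : ℝ)..1, deriv F (ux x t) * φ'' (ux x t) * uxx x t ^ 2 =
      (∫ x in (0 : ℝ)..1, φ (ux x s)) - ∫ x in (0 : ℝ)..1, φ (ux x T) := by
  have hsub : Icc s T ⊆ Ici 0 := fun t ht => hs.trans ht.1
  have hc : Continuous φ := continuous_iff_continuousAt.2 fun r => (hφ r).continuousAt
  have hc' : Continuous φ' := continuous_iff_continuousAt.2 fun r => (hφ' r).continuousAt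
  have hcφ := hc.comp_continuousOn hu.cont_ux
  have hD := (hu.continuousOn_dissipation hF' hφ'').mono hsub
  have h := integral_eq_sub_of_hasDerivAt_of_le hsT
    (f := fun t => ∫ x in (0 : ℝ)..1, φ (ux x t))
    ((continuousOn_intervalIntegral_of_continuousOn hcφ 0 1).mono hsub)
    (fun t ht => ?_) (hD.neg.intervalIntegrable_of_Icc hsT)
  · rw [show (-fun t => ∫ x in (0 : ℝ)..1, deriv F (ux x t) * φ'' (ux x t) * uxx x t ^ 2) =
      fun t => -∫ x in (0 : ℝ)..1, deriv F (ux x t) * φ'' (ux x t) * uxx x t ^ 2 from rfl,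
      intervalIntegral.integral_neg] at h
    linarith
  · have ht0 : 0 < t := hs.trans_lt ht.1
    refine (hasDerivAt_intervalIntegral_of_continuousOn hcφ
      (f' := fun x t => φ' (ux x t) * utx x t)
      ((hc'.comp_continuousOn hu.cont_ux).mul hu.cont_utx) (fun x r hr =>
        (hφ _).comp r ((hu.deriv_tx x r hr.le).hasDerivAt (Ici_mem_nhds hr))) 0 1 ht0).congr_deriv ?_
    exact hu.integral_deriv_mul_utx hF hF' hH hφ' hφ'' ht0

/-- Maximum principle for `∂ₓu`, applied to `σ ∂ₓu`. -/
lemma mul_ux_le (hu : IsSmoothClassicalSolution (Ici 0) ξ F H u ux uxx uxxx ut utx)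
    (hF : Differentiable ℝ F) (hF' : Continuous (deriv F)) (hF0 : ∀ r, 0 ≤ deriv F r)
    (hH : Continuous H) {s T M σ : ℝ} (hs : 0 ≤ s) (hsT : s ≤ T)
    (hM : ∀ x ∈ Icc (0 : ℝ) 1, σ * ux x s ≤ M) {x : ℝ} (hx : x ∈ Icc (0 : ℝ) 1) :
    σ * ux x T ≤ M := by
  by_contra! hlt
  have haff : ∀ r, HasDerivAt (fun r => σ * r - M) σ r := fun r => by
    simpa using ((hasDerivAt_id r).const_mul σ).sub_const M
  have hφ : ∀ r, HasDerivAt (fun r => max 0 (σ * r - M) ^ 3)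
      (3 * max 0 (σ * r - M) ^ 2 * σ) r := fun r => by
    refine ((hasDerivAt_max_zero_pow 1 _).comp r (haff r)).congr_deriv ?_
    norm_num
  have hφ' : ∀ r, HasDerivAt (fun r => 3 * max 0 (σ * r - M) ^ 2 * σ)
      (6 * max 0 (σ * r - M) * σ ^ 2) r := fun r => by
    refine ((((hasDerivAt_max_zero_pow 0 _).comp r (haff r)).const_mul 3).mul_const σ).congr_deriv ?_
    norm_num
    ring
  have hbal := hu.integral_dissipation hF hF' hH hφ hφ' (by fun_prop) hs hsT
  have hzero : ∫ x in (0 : ℝ)..1, max 0 (σ * ux x s - M) ^ 3 = 0 := by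
    refine (integral_congr (g := fun _ => (0 : ℝ)) fun y hy => ?_).trans (by simp)
    rw [uIcc_of_le zero_le_one] at hy
    simp [max_eq_left (sub_nonpos.2 (hM y hy))]
  have hdiss : 0 ≤ ∫ t in s..T, ∫ x in (0 : ℝ)..1,
      deriv F (ux x t) * (6 * max 0 (σ * ux x t - M) * σ ^ 2) * uxx x t ^ 2 :=
    integral_nonneg hsT fun t _ => integral_nonneg zero_le_one fun y _ => by
      have := hF0 (ux y t)
      positivity
  have hpos : 0 < ∫ x in (0 : ℝ)..1, max 0 (σ * ux x T - M) ^ 3 := by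
    have hux := continuous_slice_of_continuousOn hu.cont_ux (hs.trans hsT)
    refine integral_pos zero_lt_one (by fun_prop) (fun y _ => by positivity) ⟨x, hx, ?_⟩
    exact pow_pos (lt_max_of_lt_right (sub_pos.2 hlt)) 3
  linarith

lemma bddAbove_abs_ux (hu : IsSmoothClassicalSolution (Ici 0) ξ F H u ux uxx uxxx ut utx)
    {t : ℝ} (ht : 0 ≤ t) : BddAbove ((fun x => |ux x t|) '' Icc (0 : ℝ) 1) :=
  isCompact_Icc.bddAbove_image (continuous_slice_of_continuousOn hu.cont_ux ht).abs.continuousOn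

lemma sSup_abs_ux_le (hu : IsSmoothClassicalSolution (Ici 0) ξ F H u ux uxx uxxx ut utx)
    (hF : Differentiable ℝ F) (hF' : Continuous (deriv F)) (hF0 : ∀ r, 0 ≤ deriv F r)
    (hH : Continuous H) {s T : ℝ} (hs : 0 ≤ s) (hsT : s ≤ T) :
    sSup ((fun x => |ux x T|) '' Icc (0 : ℝ) 1) ≤ sSup ((fun x => |ux x s|) '' Icc (0 : ℝ) 1) := by
  have hM : ∀ x ∈ Icc (0 : ℝ) 1, |ux x s| ≤ sSup ((fun x => |ux x s|) '' Icc (0 : ℝ) 1) :=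
    fun x hx => le_csSup (hu.bddAbove_abs_ux hs) (mem_image_of_mem _ hx)
  refine csSup_le ((nonempty_Icc.2 zero_le_one).image _) ?_
  rintro _ ⟨x, hx, rfl⟩
  refine abs_le'.2 ⟨?_, ?_⟩
  · simpa using hu.mul_ux_le (σ := 1) hF hF' hF0 hH hs hsT
      (fun y hy => by simpa using (le_abs_self _).trans (hM y hy)) hx
  · simpa using hu.mul_ux_le (σ := -1) hF hF' hF0 hH hs hsT
      (fun y hy => by simpa using (neg_le_abs _).trans (hM y hy)) hx

/-- The supremum of `|∂ₓu|` is controlled by the dissipation, since `∂ₓu` has a zero. -/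
lemma sq_integral_sSup_le (hu : IsSmoothClassicalSolution (Ici 0) ξ F H u ux uxx uxxx ut utx)
    {g : ℝ → ℝ} (hg : Continuous g) (heven : ∀ r, g (-r) = g r) {t : ℝ} (ht : 0 ≤ t) :
    (∫ w in (0 : ℝ)..sSup ((fun x => |ux x t|) '' Icc (0 : ℝ) 1), g w) ^ 2 ≤
      ∫ x in (0 : ℝ)..1, (g (ux x t) * uxx x t) ^ 2 := by
  have hux := continuous_slice_of_continuousOn hu.cont_ux ht
  have huxx := continuous_slice_of_continuousOn hu.cont_uxx ht
  obtain ⟨z, hz, hz0⟩ := exists_hasDerivAt_eq_zero (zero_lt_one' ℝ)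
    (continuous_slice_of_continuousOn hu.cont_u ht).continuousOn
    (by simpa using (hu.periodic 0 t).symm)
    (fun x _ => hu.deriv_x x t ht)
  obtain ⟨x, hx, hxM⟩ := (isCompact_Icc.image hux.abs).sSup_mem
    ((nonempty_Icc.2 (zero_le_one' ℝ)).image _)
  have hodd : (∫ w in (0 : ℝ)..|ux x t|, g w) ^ 2 = (∫ w in (0 : ℝ)..ux x t, g w) ^ 2 := by
    rcases abs_choice (ux x t) with h | h <;> rw [h]
    have := integral_comp_neg (a := 0) (b := ux x t) g
    simp only [heven, neg_zero] at this
    rw [this, integral_symm, neg_sq]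
  have hsub : ∫ w in (0 : ℝ)..ux x t, g w = ∫ y in z..x, g (ux y t) * uxx y t := by
    have h := integral_comp_mul_deriv (a := z) (b := x)
      (fun y _ => hu.deriv_xx y t ht) huxx.continuousOn hg
    rw [hz0] at h
    exact h.symm
  have habs : |∫ y in z..x, g (ux y t) * uxx y t| ≤ ∫ y in (0 : ℝ)..1, |g (ux y t) * uxx y t| := by
    refine (norm_integral_le_integral_norm_uIoc (μ := volume)
      (f := fun y => g (ux y t) * uxx y t)).trans ?_
    rw [integral_of_le zero_le_one]
    refine setIntegral_mono_set ?_ (.of_forall fun _ => abs_nonneg _)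
      (Filter.Eventually.of_forall ?_)
    · exact (Continuous.integrableOn_Icc (by fun_prop)).mono_set Ioc_subset_Icc_self
    · exact Ioc_subset_Ioc (le_min hz.1.le hx.1) (max_le hz.2.le hx.2)
  rw [← hxM, hodd, hsub, ← sq_abs]
  exact (pow_le_pow_left₀ (abs_nonneg _) habs 2).trans (sq_intervalIntegral_abs_le (by fun_prop))

end IsSmoothClassicalSolution

/-- Let `ξ ∈ C¹([0,∞))`, `F ∈ C²(ℝ)` with `F' ≥ 0` and `F'` even,
`H ∈ C¹(ℝ)`, `E : ℝ → [0,∞)` smooth, convex and even, and set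
`G r := ∫_0^r (F'(w) E''(w))^{1/2} dw`. Let `u` be a smooth classical solution of
`du = ∂ₓ(F(∂ₓu)) dt + H(∂ₓu) dξ` on `𝕋 × [0,∞)`. Then there is a universal constant
`C > 0` such that for all `T > 0`:
`G(‖∂ₓu(·,T)‖_∞)² ≤ (C/T) ∫_𝕋 E(∂ₓu(x,0)) dx`. -/
theorem degenerate_dissipation_decay :
    ∃ C : ℝ, 0 < C ∧
      ∀ ξ F H : ℝ → ℝ, ContDiff ℝ 1 ξ → ContDiff ℝ 2 F →
        (∀ r : ℝ, 0 ≤ deriv F r) → (∀ r : ℝ, deriv F (-r) = deriv F r) →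
        ContDiff ℝ 1 H →
      ∀ E : ℝ → ℝ, ContDiff ℝ (⊤ : ℕ∞) E → ConvexOn ℝ Set.univ E →
        (∀ r, 0 ≤ E r) → (∀ r, E (-r) = E r) →
      ∀ u ux uxx uxxx ut utx : ℝ → ℝ → ℝ,
        IsSmoothClassicalSolution (Set.Ici 0) ξ F H u ux uxx uxxx ut utx →
      ∀ T : ℝ, 0 < T →
        (∫ w in (0 : ℝ)..(sSup ((fun x => |ux x T|) '' Set.Icc (0 : ℝ) 1)),
            Real.sqrt (deriv F w * deriv (deriv E) w)) ^ 2
          ≤ (C / T) * ∫ x in (0 : ℝ)..1, E (ux x 0) := by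
  refine ⟨1, one_pos, ?_⟩
  intro ξ F H _ hF hF0 hFe hH E hE hEconv hE0 hEe u ux uxx uxxx ut utx hu T hT
  have hFd := hF.differentiable (by norm_num)
  have hF' := hF.continuous_deriv (by norm_num)
  have hEd := (contDiff_infty_iff_deriv.1 hE).1
  have hE' := (contDiff_infty_iff_deriv.1 hE).2
  have hE'd := (contDiff_infty_iff_deriv.1 hE').1
  have hE'' : Continuous (deriv (deriv E)) := (contDiff_infty_iff_deriv.1 hE').2.continuous
  have hE''0 : ∀ r, 0 ≤ deriv (deriv E) r := fun r =>
    (monotoneOn_univ.1 (hEconv.monotoneOn_deriv fun x _ => hEd x)).deriv_nonneg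
  have hE'o : ∀ r, deriv E (-r) = -deriv E r := fun r => by
    have h := deriv_comp_neg E r
    simp only [hEe] at h
    linarith
  have hE''e : ∀ r, deriv (deriv E) (-r) = deriv (deriv E) r := fun r => by
    have h := deriv_comp_neg (deriv E) r
    simp only [hE'o, deriv.fun_neg] at h
    linarith
  set M : ℝ → ℝ := fun t => sSup ((fun x => |ux x t|) '' Icc (0 : ℝ) 1)
  set g : ℝ → ℝ := fun w => √(deriv F w * deriv (deriv E) w) with hg
  have hgc : Continuous g := by fun_prop
  have hM0 : 0 ≤ M T := Real.sSup_nonneg (by rintro _ ⟨x, -, rfl⟩; exact abs_nonneg _)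
  have hkey : ∀ t ∈ Icc 0 T, (∫ w in (0 : ℝ)..M T, g w) ^ 2 ≤
      ∫ x in (0 : ℝ)..1, deriv F (ux x t) * deriv (deriv E) (ux x t) * uxx x t ^ 2 := fun t ht => by
    have hmono : ∫ w in (0 : ℝ)..M T, g w ≤ ∫ w in (0 : ℝ)..M t, g w :=
      integral_mono_interval le_rfl hM0
        (hu.sSup_abs_ux_le hFd hF' hF0 hH.continuous ht.1 ht.2)
        (.of_forall fun w => Real.sqrt_nonneg _) (hgc.intervalIntegrable _ _)
    refine (pow_le_pow_left₀ (integral_nonneg hM0 fun w _ => Real.sqrt_nonneg _) hmono 2).trans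
      ((hu.sq_integral_sSup_le hgc (fun r => by simp only [hg, hFe, hE''e]) ht.1).trans_eq ?_)
    congr 1 with x
    rw [mul_pow, Real.sq_sqrt (mul_nonneg (hF0 _) (hE''0 _))]
  have hbal := hu.integral_dissipation hFd hF' hH.continuous (fun r => (hEd r).hasDerivAt)
    (fun r => (hE'd r).hasDerivAt) hE'' le_rfl hT.le
  have hint := integral_mono_on hT.le (intervalIntegrable_const (μ := volume))
    (((hu.continuousOn_dissipation hF' hE'').mono
      fun t ht => ht.1).intervalIntegrable_of_Icc hT.le) hkey
  have hfin : 0 ≤ ∫ x in (0 : ℝ)..1, E (ux x T) := integral_nonneg zero_le_one fun x _ => hE0 _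
  rw [intervalIntegral.integral_const, smul_eq_mul, sub_zero] at hint
  rw [one_div, ← div_eq_inv_mul, le_div_iff₀ hT]
  linarith
end

section
/- In the abstract semigroup setting: (i) if φ ∈ E⁺ then S₋(T)φ ≤ φ for all T ≥ 0, and if φ ∈ E⁻ then S₊(T)φ ≥ φ for all T ≥ 0; (ii) S₊(∞) maps E⁻ into E⁺, S₋(∞) maps E⁺ into E⁻, and these two maps are mutually inverse bijections between E⁻ and E⁺. -/
open Filter Topology

instance : Fact ((0 : ℝ) < 1) := ⟨one_pos⟩

/-- The `d`-dimensional torus `𝕋^d = (ℝ/ℤ)^d`. -/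
abbrev Torus (d : ℕ) := Fin d → AddCircle (1 : ℝ)

/-- The abstract semigroup setting: two semigroups `S₊ = Sp`, `S₋ = Sm` on an ordered
normed space `X` of continuous functions, each `S_±(t)` order-preserving and
nonexpansive, satisfying the order inequality `S₋(t)(S₊(t)u) ≤ u ≤ S₊(t)(S₋(t)u)`,
and such that the uniform limits `S₊(∞)u = Spinf u` and `S₋(∞)u = Sminf u` exist. -/
structure SGSetting {X : Type*} [NormedAddCommGroup X] [PartialOrder X]
    (Sp Sm : ℝ → X → X) (Spinf Sminf : X → X) : Prop where
  Sp_zero : ∀ u, Sp 0 u = u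
  Sm_zero : ∀ u, Sm 0 u = u
  Sp_add : ∀ s t : ℝ, 0 ≤ s → 0 ≤ t → ∀ u, Sp (s + t) u = Sp s (Sp t u)
  Sm_add : ∀ s t : ℝ, 0 ≤ s → 0 ≤ t → ∀ u, Sm (s + t) u = Sm s (Sm t u)
  Sp_mono : ∀ t : ℝ, 0 ≤ t → ∀ u v, u ≤ v → Sp t u ≤ Sp t v
  Sm_mono : ∀ t : ℝ, 0 ≤ t → ∀ u v, u ≤ v → Sm t u ≤ Sm t v
  Sp_nonexp : ∀ t : ℝ, 0 ≤ t → ∀ u v, ‖Sp t u - Sp t v‖ ≤ ‖u - v‖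
  Sm_nonexp : ∀ t : ℝ, 0 ≤ t → ∀ u v, ‖Sm t u - Sm t v‖ ≤ ‖u - v‖
  order_le : ∀ t : ℝ, 0 ≤ t → ∀ u, Sm t (Sp t u) ≤ u
  order_ge : ∀ t : ℝ, 0 ≤ t → ∀ u, u ≤ Sp t (Sm t u)
  Sp_lim : ∀ u, Tendsto (fun T : ℝ => Sp T u) atTop (nhds (Spinf u))
  Sm_lim : ∀ u, Tendsto (fun T : ℝ => Sm T u) atTop (nhds (Sminf u))

/-- `φ ∈ E⁺`: a fixed point of the forward semigroup. -/
def IsFixedPlus {X : Type*} (Sp : ℝ → X → X) (φ : X) : Prop :=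
  ∀ t : ℝ, 0 ≤ t → Sp t φ = φ

/-- `φ ∈ E⁻`: a fixed point of the backward semigroup. -/
def IsFixedMinus {X : Type*} (Sm : ℝ → X → X) (φ : X) : Prop :=
  ∀ t : ℝ, 0 ≤ t → Sm t φ = φ

namespace SGSetting

variable {X : Type*} [NormedAddCommGroup X] [PartialOrder X]
  {Sp Sm : ℝ → X → X} {Spinf Sminf : X → X}

/-- Reversing the order exchanges the roles of the two semigroups. -/
theorem dual (h : SGSetting Sp Sm Spinf Sminf) :
    SGSetting (X := Xᵒᵈ) Sm Sp Sminf Spinf where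
  Sp_zero := h.Sm_zero
  Sm_zero := h.Sp_zero
  Sp_add := h.Sm_add
  Sm_add := h.Sp_add
  Sp_mono t ht u v := h.Sm_mono t ht v u
  Sm_mono t ht u v := h.Sp_mono t ht v u
  Sp_nonexp := h.Sm_nonexp
  Sm_nonexp := h.Sp_nonexp
  order_le := h.order_ge
  order_ge := h.order_le
  Sp_lim := h.Sm_lim
  Sm_lim := h.Sp_lim

theorem le_Sp (h : SGSetting Sp Sm Spinf Sminf) {φ : X} (hφ : IsFixedMinus Sm φ)
    {T : ℝ} (hT : 0 ≤ T) : φ ≤ Sp T φ := by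
  simpa only [hφ T hT] using h.order_ge T hT φ

theorem continuous_Sp (h : SGSetting Sp Sm Spinf Sminf) {t : ℝ} (ht : 0 ≤ t) :
    Continuous (Sp t) :=
  (LipschitzWith.of_dist_le_mul (K := 1) fun u v => by
    simpa [dist_eq_norm] using h.Sp_nonexp t ht u v).continuous

theorem isFixedPlus_Spinf (h : SGSetting Sp Sm Spinf Sminf) (u : X) :
    IsFixedPlus Sp (Spinf u) := fun t ht => by
  refine tendsto_nhds_unique (((h.continuous_Sp ht).tendsto _).comp (h.Sp_lim u))
    (((h.Sp_lim u).comp (tendsto_atTop_add_const_left _ t tendsto_id)).congr' ?_)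
  filter_upwards [eventually_ge_atTop 0] with T hT using h.Sp_add t T ht hT u

theorem Sminf_Spinf [OrderClosedTopology X] (h : SGSetting Sp Sm Spinf Sminf) {φ : X}
    (hφ : IsFixedMinus Sm φ) : Sminf (Spinf φ) = φ := by
  apply le_antisymm
  · have hdiff : Tendsto (fun T => Sm T (Spinf φ) - Sm T (Sp T φ)) atTop (𝓝 0) := by
      refine squeeze_zero_norm' ?_ (tendsto_iff_norm_sub_tendsto_zero.1 (h.Sp_lim φ))
      filter_upwards [eventually_ge_atTop 0] with T hT
      rw [norm_sub_rev (Sp T φ)]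
      exact h.Sm_nonexp T hT _ _
    have hlim : Tendsto (fun T => Sm T (Sp T φ)) atTop (𝓝 (Sminf (Spinf φ))) := by
      simpa using (h.Sm_lim (Spinf φ)).sub hdiff
    refine le_of_tendsto hlim ?_
    filter_upwards [eventually_ge_atTop 0] with T hT using h.order_le T hT φ
  · have hle : φ ≤ Spinf φ := by
      refine ge_of_tendsto (h.Sp_lim φ) ?_
      filter_upwards [eventually_ge_atTop 0] with T hT using h.le_Sp hφ hT
    refine ge_of_tendsto (h.Sm_lim _) ?_
    filter_upwards [eventually_ge_atTop 0] with T hT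
    simpa only [hφ T hT] using h.Sm_mono T hT _ _ hle

end SGSetting

theorem ContinuousMap.orderClosedTopology {α β : Type*} [TopologicalSpace α]
    [TopologicalSpace β] [PartialOrder β] [OrderClosedTopology β] :
    OrderClosedTopology C(α, β) where
  isClosed_le' := by
    simp only [ContinuousMap.le_def, Set.ofPred_forall]
    exact isClosed_iInter fun x => isClosed_le
      ((continuous_eval_const x).comp continuous_fst)
      ((continuous_eval_const x).comp continuous_snd)

/-- In the abstract semigroup setting on `X = C(𝕋^d; ℝ)`:
(i) if `φ ∈ E⁺` then `S₋(T)φ ≤ φ` for all `T ≥ 0`, and if `φ ∈ E⁻` then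
`S₊(T)φ ≥ φ` for all `T ≥ 0`; (ii) `S₊(∞)` maps `E⁻` into `E⁺`, `S₋(∞)` maps `E⁺`
into `E⁻`, and these two maps are mutually inverse bijections between `E⁻` and `E⁺`. -/
theorem conjugate_solutions_bijection (d : ℕ)
    (Sp Sm : ℝ → C(Torus d, ℝ) → C(Torus d, ℝ))
    (Spinf Sminf : C(Torus d, ℝ) → C(Torus d, ℝ))
    (h : SGSetting Sp Sm Spinf Sminf) :
    (∀ φ, IsFixedPlus Sp φ → ∀ T : ℝ, 0 ≤ T → Sm T φ ≤ φ) ∧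
    (∀ φ, IsFixedMinus Sm φ → ∀ T : ℝ, 0 ≤ T → φ ≤ Sp T φ) ∧
    (∀ φ, IsFixedMinus Sm φ → IsFixedPlus Sp (Spinf φ)) ∧
    (∀ φ, IsFixedPlus Sp φ → IsFixedMinus Sm (Sminf φ)) ∧
    (∀ φ, IsFixedMinus Sm φ → Sminf (Spinf φ) = φ) ∧
    (∀ φ, IsFixedPlus Sp φ → Spinf (Sminf φ) = φ) := by
  have : OrderClosedTopology C(Torus d, ℝ) := ContinuousMap.orderClosedTopology
  exact ⟨fun _ hφ _ hT => h.dual.le_Sp hφ hT, fun _ hφ _ hT => h.le_Sp hφ hT,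
    fun φ _ => h.isFixedPlus_Spinf φ, fun φ _ => h.dual.isFixedPlus_Spinf φ,
    fun _ hφ => h.Sminf_Spinf hφ, fun _ hφ => h.dual.Sminf_Spinf hφ⟩
end
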